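/- Gauge invariance of the constrained mechanical model with magnetic potential: let x, p : ℝ → ℝ^n and λ, ε : ℝ → ℝ^r be smooth curves, define along them the gauge variations δx^i := Σ_a ε^a ∂G_a/∂p_i(x,p), δp_i := −Σ_a ε^a ( ∂G_a/∂x^i(x,p) + Σ_j B_{ij}(x) ∂G_a/∂p_j(x,p) ), δλ^a := dε^a/dt − Σ_{b,c} C^a_{bc}(x,p) λ^b ε^c, and let δL(t) be the derivative at s = 0 of L_s(t) := Σ_i ( p_i + s δp_i − A_i(x + s δx) ) · d(x^i + s δx^i)/dt − Σ_a ( λ^a + s δλ^a ) G_a(x + s δx, p + s δp). Then for all t, δL(t) = d/dt [ Σ_a ε^a ( Σ_i ( p_i − A_i(x) ) ∂G_a/∂p_i(x,p) − G_a(x,p) ) ]; in particular the action ∫ L dt is invariant for compactly supported ε. -/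

import Mathlib

open scoped BigOperators

/-- `∂f/∂x^i` on phase space `ℝ^n × ℝ^n`. -/
noncomputable def pdx {n : ℕ} (f : (Fin n → ℝ) × (Fin n → ℝ) → ℝ) (i : Fin n)
    (z : (Fin n → ℝ) × (Fin n → ℝ)) : ℝ :=
  fderiv ℝ f z (Pi.single i 1, 0)

/-- `∂f/∂p_i` on phase space `ℝ^n × ℝ^n`. -/
noncomputable def pdp {n : ℕ} (f : (Fin n → ℝ) × (Fin n → ℝ) → ℝ) (i : Fin n)
    (z : (Fin n → ℝ) × (Fin n → ℝ)) : ℝ :=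
  fderiv ℝ f z (0, Pi.single i 1)

/-- Partial derivative in the `i`-th coordinate direction on `ℝ^n`. -/
noncomputable def pdv {n : ℕ} (f : (Fin n → ℝ) → ℝ) (i : Fin n) (x : Fin n → ℝ) : ℝ :=
  fderiv ℝ f x (Pi.single i 1)

/-- The `B`-twisted (magnetic) bracket on `ℝ^n × ℝ^n`. -/
noncomputable def pbrB {n : ℕ} (B : Fin n → Fin n → (Fin n → ℝ) → ℝ)
    (f g : (Fin n → ℝ) × (Fin n → ℝ) → ℝ) (z : (Fin n → ℝ) × (Fin n → ℝ)) : ℝ :=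
  (∑ i, (pdx f i z * pdp g i z - pdp f i z * pdx g i z))
    - ∑ i, ∑ j, B i j z.1 * pdp f i z * pdp g j z

theorem fderiv_phase_expand {n : ℕ} (f : (Fin n → ℝ) × (Fin n → ℝ) → ℝ)
    (z : (Fin n → ℝ) × (Fin n → ℝ)) (v w : Fin n → ℝ) :
    fderiv ℝ f z (v, w) = (∑ i, pdx f i z * v i) + ∑ i, pdp f i z * w i := by
  have hv : (v, w) = (∑ i, v i • ((Pi.single i 1, 0) : (Fin n → ℝ) × (Fin n → ℝ)))
      + ∑ i, w i • ((0, Pi.single i 1) : (Fin n → ℝ) × (Fin n → ℝ)) := by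
    ext j <;> simp [Prod.fst_sum, Prod.snd_sum, Finset.sum_apply, Pi.single_apply]
  rw [hv, map_add, map_sum, map_sum]
  simp only [map_smul, smul_eq_mul, pdx, pdp, mul_comm]

theorem fderiv_config_expand {n : ℕ} (f : (Fin n → ℝ) → ℝ) (z v : Fin n → ℝ) :
    fderiv ℝ f z v = ∑ i, pdv f i z * v i := by
  have hv : v = ∑ i, v i • (Pi.single i 1 : Fin n → ℝ) := by
    ext j; simp [Finset.sum_apply, Pi.single_apply]
  conv_lhs => rw [hv, map_sum]
  simp only [map_smul, smul_eq_mul, pdv, mul_comm]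

/-- The purely algebraic identity behind gauge invariance. -/
theorem gauge_algebra {n r : ℕ} (dA B : Fin n → Fin n → ℝ)
    (hB : ∀ i j, B i j = dA j i - dA i j)
    (g l e de dl : Fin r → ℝ) (gx gp : Fin r → Fin n → ℝ) (C : Fin r → Fin r → Fin r → ℝ)
    (hfc : ∀ a b, (∑ i, (gx a i * gp b i - gp a i * gx b i))
      - ∑ i, ∑ j, B i j * gp a i * gp b j = ∑ c, C a b c * g c)
    (X P q D dx dp : Fin n → ℝ)
    (hdx : ∀ i, dx i = ∑ a, e a * gp a i)
    (hdp : ∀ i, dp i = -∑ a, e a * (gx a i + ∑ j, B i j * gp a j))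
    (hdl : ∀ a, dl a = de a - ∑ b, ∑ c, C b c a * l b * e c) :
    (∑ i, ((dp i - ∑ j, dA i j * dx j) * X i + q i * D i))
      - ∑ a, (dl a * g a + l a * ((∑ i, gx a i * dx i) + ∑ i, gp a i * dp i))
    = (∑ i, ((P i - ∑ j, dA i j * X j) * dx i + q i * D i))
      - ∑ a, (de a * g a + e a * ((∑ i, gx a i * X i) + ∑ i, gp a i * P i)) := by
  have hdp' : ∀ i, dp i = -(∑ a, e a * gx a i) - ∑ j, B i j * dx j := by
    intro i
    have : ∑ j, B i j * dx j = ∑ a, e a * ∑ j, B i j * gp a j := by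
      simp only [hdx, Finset.mul_sum]
      rw [Finset.sum_comm]
      exact Finset.sum_congr rfl fun _ _ => Finset.sum_congr rfl fun _ _ => by ring
    rw [this, hdp]
    simp only [mul_add, Finset.sum_add_distrib]
    ring
  -- the constraint part
  have h1 : ∑ a, (dl a * g a + l a * ((∑ i, gx a i * dx i) + ∑ i, gp a i * dp i))
      = ∑ a, de a * g a := by
    have h2 : ∀ a, (∑ i, gx a i * dx i) + ∑ i, gp a i * dp i
        = ∑ b, e b * ∑ c, C a b c * g c := by
      intro a
      simp only [← hfc]
      have e1 : ∑ i, gx a i * dx i = ∑ b, e b * ∑ i, gx a i * gp b i := by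
        simp only [hdx, Finset.mul_sum]
        rw [Finset.sum_comm]
        exact Finset.sum_congr rfl fun _ _ => Finset.sum_congr rfl fun _ _ => by ring
      have e2 : ∑ i, gp a i * dp i = -∑ b, e b * ((∑ i, gp a i * gx b i)
          + ∑ i, ∑ j, B i j * gp a i * gp b j) := by
        simp only [hdp, mul_neg, Finset.sum_neg_distrib]
        congr 1
        simp only [Finset.mul_sum, ← Finset.sum_add_distrib]
        rw [Finset.sum_comm]
        refine Finset.sum_congr rfl fun _ _ => Finset.sum_congr rfl fun _ _ => ?_
        simp only [mul_add, Finset.mul_sum]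
        congr 1
        · ring
        · exact Finset.sum_congr rfl fun _ _ => by ring
      rw [e1, e2, ← Finset.sum_neg_distrib, ← Finset.sum_add_distrib]
      refine Finset.sum_congr rfl fun _ _ => ?_
      rw [Finset.sum_sub_distrib]
      ring
    have h3 : ∑ a, (∑ b, ∑ c, C b c a * l b * e c) * g a
        = ∑ a, l a * ∑ b, e b * ∑ c, C a b c * g c := by
      simp only [Finset.mul_sum, Finset.sum_mul]
      rw [Finset.sum_comm]
      refine Finset.sum_congr rfl fun _ _ => ?_
      rw [Finset.sum_comm]
      exact Finset.sum_congr rfl fun _ _ => Finset.sum_congr rfl fun _ _ => by ring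
    simp only [h2, hdl, sub_mul, Finset.sum_add_distrib, Finset.sum_sub_distrib]
    rw [h3]; ring
  have h4 : ∑ a, e a * ((∑ i, gx a i * X i) + ∑ i, gp a i * P i)
      = ∑ i, ((∑ a, e a * gx a i) * X i + dx i * P i) := by
    simp only [hdx, Finset.mul_sum, Finset.sum_mul, mul_add, ← Finset.sum_add_distrib]
    rw [Finset.sum_comm]
    exact Finset.sum_congr rfl fun _ _ => Finset.sum_congr rfl fun _ _ => by ring
  have h5 : ∑ i, (∑ j, dA i j * X j) * dx i = ∑ i, (∑ j, dA j i * dx j) * X i := by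
    simp only [Finset.sum_mul]
    rw [Finset.sum_comm]
    exact Finset.sum_congr rfl fun _ _ => Finset.sum_congr rfl fun _ _ => by ring
  rw [h1, Finset.sum_add_distrib (f := fun a => de a * g a), h4]
  have h6 : ∀ i, dp i = -(∑ a, e a * gx a i) - (∑ j, dA j i * dx j) + ∑ j, dA i j * dx j := by
    intro i
    rw [hdp' i]
    simp only [hB, sub_mul, Finset.sum_sub_distrib]
    ring
  simp only [sub_mul, Finset.sum_add_distrib, Finset.sum_sub_distrib, h5]
  simp only [h6, add_mul, sub_mul, neg_mul, Finset.sum_add_distrib, Finset.sum_sub_distrib,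
    Finset.sum_neg_distrib, mul_comm (P _)]
  ring

/-- Gauge invariance of the constrained mechanical model with magnetic potential `A`
(`B = dA`): the variation of the Lagrangian
`L = Σ_i (p_i − A_i(x)) ẋ^i − Σ_a λ^a G_a` under the gauge transformation generated by the
first-class constraints `G_a` is the total time derivative
`d/dt [ Σ_a ε^a ( Σ_i (p_i − A_i(x)) ∂G_a/∂p_i − G_a ) ]`. -/
theorem gauge_invariance_magnetic_model {n r : ℕ}
    (A : Fin n → (Fin n → ℝ) → ℝ) (hA : ∀ i, ContDiff ℝ (⊤ : ℕ∞) (A i))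
    (B : Fin n → Fin n → (Fin n → ℝ) → ℝ)
    (hB : ∀ i j x, B i j x = pdv (A j) i x - pdv (A i) j x)
    (G : Fin r → (Fin n → ℝ) × (Fin n → ℝ) → ℝ)
    (hG : ∀ a, ContDiff ℝ (⊤ : ℕ∞) (G a))
    (C : Fin r → Fin r → Fin r → (Fin n → ℝ) × (Fin n → ℝ) → ℝ)
    (hC : ∀ a b c, ContDiff ℝ (⊤ : ℕ∞) (C a b c))
    (hCanti : ∀ a b c z, C a b c z = - C b a c z)
    (hfc : ∀ a b z, pbrB B (G a) (G b) z = ∑ c, C a b c z * G c z)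
    (x p : ℝ → Fin n → ℝ) (lam ε : ℝ → Fin r → ℝ)
    (hx : ContDiff ℝ (⊤ : ℕ∞) x) (hp : ContDiff ℝ (⊤ : ℕ∞) p)
    (hlam : ContDiff ℝ (⊤ : ℕ∞) lam) (hε : ContDiff ℝ (⊤ : ℕ∞) ε)
    (dx : ℝ → Fin n → ℝ)
    (hdx : ∀ t i, dx t i = ∑ a, ε t a * pdp (G a) i (x t, p t))
    (dp : ℝ → Fin n → ℝ)
    (hdp : ∀ t i, dp t i =
      -∑ a, ε t a * (pdx (G a) i (x t, p t) + ∑ j, B i j (x t) * pdp (G a) j (x t, p t)))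
    (dlam : ℝ → Fin r → ℝ)
    (hdlam : ∀ t a, dlam t a =
      deriv (fun u => ε u a) t - ∑ b, ∑ c, C b c a (x t, p t) * lam t b * ε t c)
    (L : ℝ → ℝ → ℝ)
    (hL : ∀ s t, L s t =
      (∑ i, (p t i + s * dp t i - A i (fun j => x t j + s * dx t j))
          * deriv (fun u => x u i + s * dx u i) t)
        - ∑ a, (lam t a + s * dlam t a)
            * G a (fun j => x t j + s * dx t j, fun j => p t j + s * dp t j)) :
    ∀ t, deriv (fun s => L s t) 0
        = deriv (fun u => ∑ a, ε u a *
            ((∑ i, (p u i - A i (x u)) * pdp (G a) i (x u, p u)) - G a (x u, p u))) t := by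
  intro t
  have hx' : ∀ t, HasDerivAt x (deriv x t) t := fun t =>
    (hx.differentiable (by simp) t).hasDerivAt
  have hp' : ∀ t, HasDerivAt p (deriv p t) t := fun t =>
    (hp.differentiable (by simp) t).hasDerivAt
  have hε' : ∀ t, HasDerivAt ε (deriv ε t) t := fun t =>
    (hε.differentiable (by simp) t).hasDerivAt
  have hxi : ∀ i, HasDerivAt (fun u => x u i) (deriv x t i) t := hasDerivAt_pi.1 (hx' t)
  have hpi : ∀ i, HasDerivAt (fun u => p u i) (deriv p t i) t := hasDerivAt_pi.1 (hp' t)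
  have hεi : ∀ i, HasDerivAt (fun u => ε u i) (deriv ε t i) t := hasDerivAt_pi.1 (hε' t)
  have hpd : ∀ a i, Differentiable ℝ (pdp (G a) i) := by
    intro a i
    have h : ContDiff ℝ 1 (fderiv ℝ (G a)) := 
      (contDiff_infty.1 (hG a) 2).fderiv_right (by norm_num [one_add_one_eq_two])
    exact (h.differentiable (by simp)).clm_apply (differentiable_const _)
  have hz : ∀ t, HasDerivAt (fun u => (x u, p u)) (deriv x t, deriv p t) t := fun t =>
    (hx' t).prodMk (hp' t)
  have hdxd : ∀ i, HasDerivAt (fun u => dx u i) (deriv (fun u => dx u i) t) t := by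
    intro i
    apply DifferentiableAt.hasDerivAt
    have : (fun u => dx u i) = fun u => ∑ a, ε u a * pdp (G a) i (x u, p u) :=
      funext fun u => hdx u i
    rw [this]
    refine DifferentiableAt.fun_sum fun a _ => ?_
    have hc : DifferentiableAt ℝ (fun u => pdp (G a) i (x u, p u)) t :=
      DifferentiableAt.comp (f := fun u => (x u, p u)) t (hpd a i (x t, p t))
        (hz t).differentiableAt
    exact (hεi a).differentiableAt.mul hc
  have hGd : ∀ a z, HasFDerivAt (G a) (fderiv ℝ (G a) z) z := fun a z =>
    ((hG a).differentiable (by simp) z).hasFDerivAt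
  have hAd : ∀ a z, HasFDerivAt (A a) (fderiv ℝ (A a) z) z := fun a z =>
    ((hA a).differentiable (by simp) z).hasFDerivAt
  -- left hand side
  have hlin : ∀ a b : ℝ, HasDerivAt (fun s : ℝ => a + s * b) b 0 := by
    intro a b
    simpa using ((hasDerivAt_id (0 : ℝ)).mul_const b).const_add a
  have hline : ∀ v w : Fin n → ℝ, HasDerivAt (fun (s : ℝ) j => v j + s * w j) w 0 :=
    fun v w => hasDerivAt_pi.2 fun j => hlin _ _
  have hLHS : HasDerivAt (fun s => L s t)
      ((∑ i, ((dp t i - ∑ j, pdv (A i) j (x t) * dx t j) * deriv x t i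
          + (p t i - A i (x t)) * deriv (fun u => dx u i) t))
        - ∑ a, (dlam t a * G a (x t, p t) + lam t a *
          ((∑ i, pdx (G a) i (x t, p t) * dx t i) + ∑ i, pdp (G a) i (x t, p t) * dp t i))) 0 := by
    have hfun : (fun s => L s t) = fun s =>
      (∑ i, (p t i + s * dp t i - A i (fun j => x t j + s * dx t j))
          * (deriv x t i + s * deriv (fun u => dx u i) t))
        - ∑ a, (lam t a + s * dlam t a)
            * G a (fun j => x t j + s * dx t j, fun j => p t j + s * dp t j) := by
      funext s
      rw [hL]
      congr 1
      refine Finset.sum_congr rfl fun i _ => ?_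
      congr 1
      exact ((hxi i).add ((hdxd i).const_mul s)).deriv
    rw [hfun]
    refine HasDerivAt.sub (HasDerivAt.fun_sum fun i _ => ?_) (HasDerivAt.fun_sum fun a _ => ?_)
    · have hA0 : HasDerivAt (fun s : ℝ => A i (fun j => x t j + s * dx t j))
          (∑ j, pdv (A i) j (x t) * dx t j) 0 := by
        rw [← fderiv_config_expand]
        refine HasFDerivAt.comp_hasDerivAt (f := fun (s : ℝ) j => x t j + s * dx t j) 0 ?_
          (hline _ _)
        simpa using hAd i (x t)
      have := ((hlin (p t i) (dp t i)).sub hA0).mul (hlin (deriv x t i) (deriv (fun u => dx u i) t))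
      simp only [zero_mul, add_zero, Pi.sub_apply] at this
      exact this
    · have hG0 : HasDerivAt (fun s : ℝ =>
            G a (fun j => x t j + s * dx t j, fun j => p t j + s * dp t j))
          ((∑ i, pdx (G a) i (x t, p t) * dx t i) + ∑ i, pdp (G a) i (x t, p t) * dp t i) 0 := by
        rw [← fderiv_phase_expand]
        refine HasFDerivAt.comp_hasDerivAt
          (f := fun (s : ℝ) => (fun j => x t j + s * dx t j, fun j => p t j + s * dp t j)) 0 ?_
          ((hline _ _).prodMk (hline _ _))
        simpa using hGd a (x t, p t)
      have := (hlin (lam t a) (dlam t a)).mul hG0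
      simp only [zero_mul, add_zero, Pi.sub_apply] at this
      exact this
  -- right hand side
  have hRHS : HasDerivAt (fun u => ∑ a, ε u a *
            ((∑ i, (p u i - A i (x u)) * pdp (G a) i (x u, p u)) - G a (x u, p u)))
      ((∑ i, ((deriv p t i - ∑ j, pdv (A i) j (x t) * deriv x t j) * dx t i
          + (p t i - A i (x t)) * deriv (fun u => dx u i) t))
        - ∑ a, (deriv ε t a * G a (x t, p t) + ε t a *
          ((∑ i, pdx (G a) i (x t, p t) * deriv x t i)
            + ∑ i, pdp (G a) i (x t, p t) * deriv p t i))) t := by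
    have hfun : (fun u => ∑ a, ε u a *
            ((∑ i, (p u i - A i (x u)) * pdp (G a) i (x u, p u)) - G a (x u, p u)))
        = fun u => (∑ i, (p u i - A i (x u)) * dx u i) - ∑ a, ε u a * G a (x u, p u) := by
      funext u
      simp only [mul_sub, Finset.sum_sub_distrib, hdx]
      congr 1
      simp only [Finset.mul_sum]
      rw [Finset.sum_comm]
      refine Finset.sum_congr rfl fun _ _ => Finset.sum_congr rfl fun _ _ => by ring
    rw [hfun]
    refine HasDerivAt.sub (HasDerivAt.fun_sum fun i _ => ?_) (HasDerivAt.fun_sum fun a _ => ?_)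
    · rw [← fderiv_config_expand]
      exact ((hpi i).sub ((hAd i (x t)).comp_hasDerivAt t (hx' t))).mul (hdxd i)
    · rw [← fderiv_phase_expand]
      exact (hεi a).mul ((hGd a (x t, p t)).comp_hasDerivAt t (hz t))
  rw [hLHS.deriv, hRHS.deriv]
  refine gauge_algebra (fun i j => pdv (A i) j (x t)) (fun i j => B i j (x t))
    (fun i j => hB i j (x t)) (fun a => G a (x t, p t)) (lam t) (ε t) (deriv ε t) (dlam t)
    (fun a i => pdx (G a) i (x t, p t)) (fun a i => pdp (G a) i (x t, p t))
    (fun a b c => C a b c (x t, p t)) (fun a b => hfc a b (x t, p t))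
    (deriv x t) (deriv p t) (fun i => p t i - A i (x t)) (fun i => deriv (fun u => dx u i) t)
    (dx t) (dp t) (hdx t) (hdp t) ?_
  intro a
  rw [hdlam, (hεi a).deriv]
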